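/- Let α, β be real numbers with 0 < α and α² < β, and set γ = β − α². Let J3 be the 4×4 real matrix (1/γ)·[[0, 0, 1, α], [0, 0, α, β], [βγ/α, 0, 0, 0], [0, −γ, 0, 0]] (the Jacobian of the double-pendulum vector field at the equilibrium (π, 0, 0, 0)). Then J3 has exactly one positive real eigenvalue r > 0 and one negative real eigenvalue −r, and its other two eigenvalues are a conjugate pair of nonzero purely imaginary numbers ±i·s with s > 0. Hence (π, 0, 0, 0) is an index-1 saddle with saddle×center linear stability. -/

import Mathlib

open Matrix Polynomial

theorem charpoly_offDiagonal_blocks {R : Type*} [CommRing R] (a b c d e f : R) :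
    (!![0, 0, a, b; 0, 0, c, d; e, 0, 0, 0; 0, f, 0, 0] : Matrix (Fin 4) (Fin 4) R).charpoly =
      X ^ 4 - C (a * e + d * f) * X ^ 2 + C (e * f * (a * d - b * c)) := by
  simp [Matrix.charpoly, Matrix.det_succ_row_zero, Fin.sum_univ_succ, Matrix.charmatrix_apply,
    Fin.succAbove, Matrix.diagonal_apply]
  ring

theorem exists_pos_sq_sub_sq_eq_and_sq_mul_sq_eq (T : ℝ) {D : ℝ} (hD : 0 < D) :
    ∃ r s : ℝ, 0 < r ∧ 0 < s ∧ r ^ 2 - s ^ 2 = T ∧ r ^ 2 * s ^ 2 = D := by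
  have hlt : |T| < √(T ^ 2 + 4 * D) := by
    rw [← Real.sqrt_sq_eq_abs]
    exact Real.sqrt_lt_sqrt (sq_nonneg T) (by linarith)
  obtain ⟨hneg, hpos⟩ := abs_lt.mp hlt
  have hsq : √(T ^ 2 + 4 * D) ^ 2 = T ^ 2 + 4 * D := Real.sq_sqrt (by positivity)
  have hr : 0 < (√(T ^ 2 + 4 * D) + T) / 2 := by linarith
  have hs : 0 < (√(T ^ 2 + 4 * D) - T) / 2 := by linarith
  refine ⟨_, _, Real.sqrt_pos.mpr hr, Real.sqrt_pos.mpr hs, ?_, ?_⟩ <;>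
    rw [Real.sq_sqrt hr.le, Real.sq_sqrt hs.le]
  · ring
  · linear_combination hsq / 4

theorem roots_biquadratic_eq (r s : ℂ) :
    (X ^ 4 - C (r ^ 2 - s ^ 2) * X ^ 2 - C (r ^ 2 * s ^ 2) : ℂ[X]).roots =
      {r, -r, s * Complex.I, -(s * Complex.I)} := by
  have hI : (C Complex.I : ℂ[X]) ^ 2 = -1 := by
    rw [← C_pow, Complex.I_sq, C_neg, C_1]
  have hfactor : (X ^ 4 - C (r ^ 2 - s ^ 2) * X ^ 2 - C (r ^ 2 * s ^ 2) : ℂ[X]) =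
      (({r, -r, s * Complex.I, -(s * Complex.I)} : Multiset ℂ).map fun z => X - C z).prod := by
    simp only [Multiset.insert_eq_cons, Multiset.map_cons, Multiset.map_singleton,
      Multiset.prod_cons, Multiset.prod_singleton, C_neg, C_mul, C_sub, C_pow]
    linear_combination (X ^ 2 - C r ^ 2) * C s ^ 2 * hI
  rw [hfactor, roots_multiset_prod_X_sub_C]

theorem double_pendulum_saddle_center_equilibrium_pi_zero
    (α β : ℝ) (hα : 0 < α) (hβ : α ^ 2 < β)
    (γ : ℝ) (hγ : γ = β - α ^ 2)
    (J3 : Matrix (Fin 4) (Fin 4) ℝ)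
    (hJ3 : J3 = (1 / γ) •
      !![0, 0, 1, α;
         0, 0, α, β;
         β * γ / α, 0, 0, 0;
         0, -γ, 0, 0]) :
    ∃ r s : ℝ, 0 < r ∧ 0 < s ∧
      ((J3.map (algebraMap ℝ ℂ)).charpoly).roots =
        {(r : ℂ), -(r : ℂ), (s : ℂ) * Complex.I, -((s : ℂ) * Complex.I)} := by
  have hγ0 : 0 < γ := by linarith
  have hβ0 : 0 < β := (by positivity : 0 < α ^ 2).trans hβ
  obtain ⟨r, s, hr, hs, hsub, hmul⟩ :=
    exists_pos_sq_sub_sq_eq_and_sq_mul_sq_eq ((β / α - β) / γ)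
      (by positivity : 0 < β / (α * γ))
  refine ⟨r, s, hr, hs, ?_⟩
  have hJ : J3 = !![0, 0, 1 / γ, α / γ; 0, 0, α / γ, β / γ; β / α, 0, 0, 0; 0, -1, 0, 0] := by
    rw [hJ3]
    ext i j
    fin_cases i <;> fin_cases j <;> simp <;> field_simp
  have htrace : 1 / γ * (β / α) + β / γ * -1 = r ^ 2 - s ^ 2 := by
    rw [hsub]
    ring
  have hdet : β / α * -1 * (1 / γ * (β / γ) - α / γ * (α / γ)) = -(r ^ 2 * s ^ 2) := by
    rw [hmul]
    field_simp
    linear_combination hγ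
  have hchar : J3.charpoly = X ^ 4 - C (r ^ 2 - s ^ 2) * X ^ 2 - C (r ^ 2 * s ^ 2) := by
    rw [hJ, charpoly_offDiagonal_blocks, htrace, hdet, C_neg, sub_eq_add_neg _ (C (r ^ 2 * s ^ 2))]
  rw [Matrix.charpoly_map, hchar, ← roots_biquadratic_eq]
  simp
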